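/- Let r = √(x² + y² + z²) and ρ = √(x² + y²), and define W on U = {(x, y, z) ∈ ℝ³ : x² + y² > 0} by W(x, y, z) = ( z x/(r ρ) − y r/ρ², z y/(r ρ) + x r/ρ², −ρ/r ). Then for every p = (x, y, z) ∈ U: (i) ⟨W(p), p⟩ = 0, so W is tangent to every sphere centered at the origin; and (ii) W is differentiable at p and the radial component of its curl vanishes: ⟨p, curl W(p)⟩ = 0. -/

import Mathlib

open scoped RealInnerProductSpace

noncomputable def cross3 (a b : EuclideanSpace ℝ (Fin 3)) : EuclideanSpace ℝ (Fin 3) :=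
  (WithLp.equiv 2 (Fin 3 → ℝ)).symm
    ![a 1 * b 2 - a 2 * b 1, a 2 * b 0 - a 0 * b 2, a 0 * b 1 - a 1 * b 0]

/-- Divergence: trace of the Fréchet derivative. -/
noncomputable def div3 (F : EuclideanSpace ℝ (Fin 3) → EuclideanSpace ℝ (Fin 3))
    (p : EuclideanSpace ℝ (Fin 3)) : ℝ :=
  ∑ i, fderiv ℝ F p (EuclideanSpace.single i 1) i

/-- Curl of a vector field on ℝ³. -/
noncomputable def curl3 (F : EuclideanSpace ℝ (Fin 3) → EuclideanSpace ℝ (Fin 3))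
    (p : EuclideanSpace ℝ (Fin 3)) : EuclideanSpace ℝ (Fin 3) :=
  (WithLp.equiv 2 (Fin 3 → ℝ)).symm
    ![fderiv ℝ F p (EuclideanSpace.single 1 1) 2 - fderiv ℝ F p (EuclideanSpace.single 2 1) 1,
      fderiv ℝ F p (EuclideanSpace.single 2 1) 0 - fderiv ℝ F p (EuclideanSpace.single 0 1) 2,
      fderiv ℝ F p (EuclideanSpace.single 0 1) 1 - fderiv ℝ F p (EuclideanSpace.single 1 1) 0]
/-- Cartesian expression of the test field v = θ̂ + (1/sin θ) φ̂. -/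
noncomputable def Wfield (x : EuclideanSpace ℝ (Fin 3)) : EuclideanSpace ℝ (Fin 3) :=
  (WithLp.equiv 2 (Fin 3 → ℝ)).symm
    ![x 2 * x 0 / (Real.sqrt (x 0 ^ 2 + x 1 ^ 2 + x 2 ^ 2) * Real.sqrt (x 0 ^ 2 + x 1 ^ 2)) -
        x 1 * Real.sqrt (x 0 ^ 2 + x 1 ^ 2 + x 2 ^ 2) / (x 0 ^ 2 + x 1 ^ 2),
      x 2 * x 1 / (Real.sqrt (x 0 ^ 2 + x 1 ^ 2 + x 2 ^ 2) * Real.sqrt (x 0 ^ 2 + x 1 ^ 2)) +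
        x 0 * Real.sqrt (x 0 ^ 2 + x 1 ^ 2 + x 2 ^ 2) / (x 0 ^ 2 + x 1 ^ 2),
      -Real.sqrt (x 0 ^ 2 + x 1 ^ 2) / Real.sqrt (x 0 ^ 2 + x 1 ^ 2 + x 2 ^ 2)]

/-- Partial derivatives of a map into Euclidean space, computed from those of a component. -/
theorem HasFDerivAt.fderiv_euclidean_apply {n : ℕ}
    {F : EuclideanSpace ℝ (Fin n) → EuclideanSpace ℝ (Fin n)} {p : EuclideanSpace ℝ (Fin n)}
    {i : Fin n} {f' : EuclideanSpace ℝ (Fin n) →L[ℝ] ℝ} (hF : DifferentiableAt ℝ F p)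
    (h : HasFDerivAt (fun x => F x i) f' p) (v : EuclideanSpace ℝ (Fin n)) :
    fderiv ℝ F p v i = f' v := by
  have h' := (EuclideanSpace.proj i : EuclideanSpace ℝ (Fin n) →L[ℝ] ℝ).hasFDerivAt.comp p
    hF.hasFDerivAt
  exact congrArg (fun L => L v) (h'.unique h)

theorem hasFDerivAt_euclidean_coord {n : ℕ} (i : Fin n) (p : EuclideanSpace ℝ (Fin n)) :
    HasFDerivAt (fun x : EuclideanSpace ℝ (Fin n) => x i)
      (EuclideanSpace.proj i : EuclideanSpace ℝ (Fin n) →L[ℝ] ℝ) p :=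
  (EuclideanSpace.proj i : EuclideanSpace ℝ (Fin n) →L[ℝ] ℝ).hasFDerivAt

theorem HasFDerivAt.div_of_real {E : Type*} [NormedAddCommGroup E] [NormedSpace ℝ E]
    {f g : E → ℝ} {f' g' : E →L[ℝ] ℝ} {x : E} (hf : HasFDerivAt f f' x)
    (hg : HasFDerivAt g g' x) (hx : g x ≠ 0) :
    HasFDerivAt (fun y => f y / g y) ((g x ^ 2)⁻¹ • (g x • f' - f x • g')) x := by
  have h := hf.mul ((hasDerivAt_inv hx).comp_hasFDerivAt x hg)
  refine h.congr_fderiv ?_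
  ext v
  simp
  field_simp
  ring

theorem Wfield_tangent_and_radial_curl_free (p : EuclideanSpace ℝ (Fin 3))
    (hp : p 0 ^ 2 + p 1 ^ 2 > 0) :
    ⟪Wfield p, p⟫ = 0 ∧ DifferentiableAt ℝ Wfield p ∧ ⟪p, curl3 Wfield p⟫ = 0 := by
  have hq : p 0 ^ 2 + p 1 ^ 2 + p 2 ^ 2 > 0 := by positivity
  have h0 := hasFDerivAt_euclidean_coord 0 p
  have h1 := hasFDerivAt_euclidean_coord 1 p
  have h2 := hasFDerivAt_euclidean_coord 2 p
  have hs := (h0.pow 2).add (h1.pow 2)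
  have hρ := hs.sqrt hp.ne'
  have hr := (hs.add (h2.pow 2)).sqrt hq.ne'
  have ρpos : 0 < √(p 0 ^ 2 + p 1 ^ 2) := Real.sqrt_pos.2 hp
  have rpos : 0 < √(p 0 ^ 2 + p 1 ^ 2 + p 2 ^ 2) := Real.sqrt_pos.2 hq
  have ρsq := Real.sq_sqrt hp.le
  have hW0 := ((h2.mul h0).div_of_real (hr.mul hρ) (mul_pos rpos ρpos).ne').sub
    ((h1.mul hr).div_of_real hs hp.ne')
  have hW1 := ((h2.mul h1).div_of_real (hr.mul hρ) (mul_pos rpos ρpos).ne').add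
    ((h0.mul hr).div_of_real hs hp.ne')
  have hW2 := hρ.neg.div_of_real hr rpos.ne'
  have hW : DifferentiableAt ℝ Wfield p := by
    rw [differentiableAt_euclidean]
    intro i
    fin_cases i
    exacts [hW0.differentiableAt, hW1.differentiableAt, hW2.differentiableAt]
  have d0 := HasFDerivAt.fderiv_euclidean_apply (i := 0) hW hW0
  have d1 := HasFDerivAt.fderiv_euclidean_apply (i := 1) hW hW1
  have d2 := HasFDerivAt.fderiv_euclidean_apply (i := 2) hW hW2
  refine ⟨?_, hW, ?_⟩
  · simp only [PiLp.inner_apply, Fin.sum_univ_three, Wfield]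
    simp
    generalize √(p 0 ^ 2 + p 1 ^ 2 + p 2 ^ 2) = r at *
    generalize √(p 0 ^ 2 + p 1 ^ 2) = ρ at *
    field_simp
    linear_combination (-(p 2 * (p 0 ^ 2 + p 1 ^ 2))) * ρsq
  · simp only [PiLp.inner_apply, Fin.sum_univ_three, curl3, d0, d1, d2]
    clear d0 d1 d2 hW hW0 hW1 hW2 hs hρ hr h0 h1 h2
    simp
    generalize √(p 0 ^ 2 + p 1 ^ 2 + p 2 ^ 2) = r at *
    generalize √(p 0 ^ 2 + p 1 ^ 2) = ρ at *
    generalize p 0 = x at *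
    generalize p 1 = y at *
    generalize p 2 = z at *
    rw [← ρsq]
    field_simp
    linear_combination 2 * z * r ^ 4 * ρsq
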